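/- arXiv:1605.05735 — 2 statements merged into one kernel-verified Lean document; each statement's English description precedes it below -/
import Mathlib

section
/- Let A be a finite-dimensional algebra over a field F, let S_i and S_j be simple right A-modules with projective covers P_i and P_j respectively, and let n ≥ 1 be an integer. Then there is an F-linear isomorphism Hom_A(rad^{n-1}(P_i)/rad^n(P_i), S_j) ≅ Hom_A(S_i, soc^n(ν(P_j))/soc^{n-1}(ν(P_j))), i.e., the n-th radical layer of P_i and the n-th socle layer of the Nakayama transform ν(P_j) satisfy this reciprocity. -/
set_option linter.unusedSectionVars false
set_option synthInstance.maxHeartbeats 1000000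
set_option maxHeartbeats 1000000

open Module MulOpposite

/-! ### Loewy-theoretic definitions: socle, radical, their iterates and layers -/

section LoewyDefs

variable (R : Type*) [Ring R]

/-- The socle of a module: the sum of its minimal (= atomic) submodules. -/
def socSub (M : Type*) [AddCommGroup M] [Module R M] : Submodule R M :=
  sSup {m : Submodule R M | IsAtom m}

/-- The radical of a module: the intersection of its maximal (= coatomic) submodules. -/
def radSub (M : Type*) [AddCommGroup M] [Module R M] : Submodule R M :=
  sInf {m : Submodule R M | IsCoatom m}

/-- The `n`-th radical: `rad^0 M = M` and `rad^{n+1} M = rad (rad^n M)`,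
viewed as a submodule of `M`. -/
def radPow (M : Type*) [AddCommGroup M] [Module R M] : ℕ → Submodule R M
  | 0 => ⊤
  | n + 1 => (radSub R (radPow M n)).map (radPow M n).subtype

/-- The `n`-th socle: `soc^0 M = 0` and `soc^{n+1} M` is the preimage of
`soc (M / soc^n M)` under the canonical projection. -/
def socPow (M : Type*) [AddCommGroup M] [Module R M] : ℕ → Submodule R M
  | 0 => ⊥
  | n + 1 => (socSub R (M ⧸ socPow M n)).comap (socPow M n).mkQ

/-- The `n`-th radical layer `rad_n M = rad^{n-1} M / rad^n M`. -/
abbrev radLayer (M : Type*) [AddCommGroup M] [Module R M] (n : ℕ) :=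
  ↥(radPow R M (n - 1)) ⧸ (radPow R M n).comap (radPow R M (n - 1)).subtype

/-- The `n`-th socle layer `soc_n M = soc^n M / soc^{n-1} M`. -/
abbrev socLayer (M : Type*) [AddCommGroup M] [Module R M] (n : ℕ) :=
  ↥(socPow R M n) ⧸ (socPow R M (n - 1)).comap (socPow R M n).subtype

/-- The `n`-th capital `cap^n M = M / rad^n M`. -/
abbrev capital (M : Type*) [AddCommGroup M] [Module R M] (n : ℕ) :=
  M ⧸ radPow R M n

end LoewyDefs

/-! ### Contragredient dual module structures -/

section DualMod
variable (F A : Type*) [Field F] [Ring A] [Algebra F A]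

/-- Contragredient action: the `F`-dual of a right `A`-module is a left `A`-module,
via `(a • l) m = l (op a • m)`. -/
noncomputable instance dualModuleOfRight (M : Type*) [AddCommGroup M] [Module F M]
    [Module Aᵐᵒᵖ M] [SMulCommClass Aᵐᵒᵖ F M] : Module A (Module.Dual F M) where
  smul a l := l.comp (DistribMulAction.toLinearMap F M (op a))
  one_smul l := LinearMap.ext fun m => congrArg l (one_smul Aᵐᵒᵖ m)
  mul_smul a b l := LinearMap.ext fun m => congrArg l (mul_smul (op b) (op a) m)
  smul_zero a := rfl
  smul_add a l₁ l₂ := rfl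
  add_smul a b l := LinearMap.ext fun m => by
    rw [LinearMap.add_apply]
    show l (op (a + b) • m) = l (op a • m) + l (op b • m)
    rw [← map_add]
    congr 1
    show (op a + op b) • m = _
    rw [add_smul]
  zero_smul l := LinearMap.ext fun m => by
    show l ((0 : Aᵐᵒᵖ) • m) = 0
    rw [zero_smul, map_zero]

@[simp] lemma dualModuleOfRight_smul_apply (M : Type*) [AddCommGroup M] [Module F M]
    [Module Aᵐᵒᵖ M] [SMulCommClass Aᵐᵒᵖ F M] (a : A) (l : Module.Dual F M) (m : M) :
    (a • l) m = l (op a • m) := rfl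

/-- Contragredient action: the `F`-dual of a left `A`-module is a right `A`-module,
via `(a • l) m = l (a.unop • m)`. -/
noncomputable instance dualModuleOfLeft (N : Type*) [AddCommGroup N] [Module F N]
    [Module A N] [SMulCommClass A F N] : Module Aᵐᵒᵖ (Module.Dual F N) where
  smul a l := l.comp (DistribMulAction.toLinearMap F N a.unop)
  one_smul l := LinearMap.ext fun m => congrArg l (one_smul A m)
  mul_smul a b l := LinearMap.ext fun m => congrArg l (mul_smul b.unop a.unop m)
  smul_zero a := rfl
  smul_add a l₁ l₂ := rfl
  add_smul a b l := LinearMap.ext fun m => by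
    rw [LinearMap.add_apply]
    show l ((a + b).unop • m) = l (a.unop • m) + l (b.unop • m)
    rw [← map_add]
    congr 1
    show (a.unop + b.unop) • m = _
    rw [add_smul]
  zero_smul l := LinearMap.ext fun m => by
    show l ((0 : A) • m) = 0
    rw [zero_smul, map_zero]

@[simp] lemma dualModuleOfLeft_smul_apply (N : Type*) [AddCommGroup N] [Module F N]
    [Module A N] [SMulCommClass A F N] (a : Aᵐᵒᵖ) (l : Module.Dual F N) (m : N) :
    (a • l) m = l (a.unop • m) := rfl

noncomputable instance dualTowerOfRight (M : Type*) [AddCommGroup M] [Module F M]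
    [Module Aᵐᵒᵖ M] [IsScalarTower F Aᵐᵒᵖ M] : IsScalarTower F A (Module.Dual F M) where
  smul_assoc c a l := LinearMap.ext fun m => by
    show l (op (c • a) • m) = c • l (op a • m)
    rw [← map_smul]
    congr 1
    show (c • op a) • m = c • op a • m
    rw [smul_assoc]

noncomputable instance dualTowerOfLeft (N : Type*) [AddCommGroup N] [Module F N]
    [Module A N] [IsScalarTower F A N] : IsScalarTower F Aᵐᵒᵖ (Module.Dual F N) where
  smul_assoc c a l := LinearMap.ext fun m => by
    show l ((c • a).unop • m) = c • l (a.unop • m)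
    rw [← map_smul]
    congr 1
    show (c • a.unop) • m = c • a.unop • m
    rw [smul_assoc]

end DualMod

/-! ### Radical and socle series over semiprimary rings -/

section Loewy

variable (R : Type*) [Ring R] [IsSemiprimaryRing R]

theorem IsSemisimpleModule.of_jacobson_le_annihilator {M : Type*} [AddCommGroup M] [Module R M]
    (h : Ring.jacobson R ≤ Module.annihilator R M) : IsSemisimpleModule R M := by
  rw [← SetLike.coe_subset_coe, ← Module.isTorsionBySet_iff_subset_annihilator] at h
  let _ := h.module
  exact (h.semilinearMap.isSemisimpleModule_iff_of_bijective Function.bijective_id).2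
    inferInstance

theorem radSub_eq_jacobson_smul_top (M : Type*) [AddCommGroup M] [Module R M] :
    radSub R M = Ring.jacobson R • (⊤ : Submodule R M) := by
  refine le_antisymm (Module.jacobson_le_of_eq_bot ?_) (Ring.jacobson_smul_top_le R M)
  have : IsSemisimpleModule R (M ⧸ Ring.jacobson R • (⊤ : Submodule R M)) := by
    refine .of_jacobson_le_annihilator R fun r hr ↦ Module.mem_annihilator.mpr fun x ↦ ?_
    obtain ⟨x, rfl⟩ := Submodule.mkQ_surjective _ x
    rw [← map_smul, Submodule.mkQ_apply, Submodule.Quotient.mk_eq_zero]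
    exact Submodule.smul_mem_smul hr trivial
  exact IsSemisimpleModule.jacobson_eq_bot R _

theorem mem_socSub_iff {M : Type*} [AddCommGroup M] [Module R M] {x : M} :
    x ∈ socSub R M ↔ ∀ r ∈ Ring.jacobson R, r • x = 0 := by
  constructor
  · intro hx r hr
    have : IsSemisimpleModule R (socSub R M) := by
      rw [socSub, sSup_eq_iSup]
      exact isSemisimpleModule_biSup_of_isSemisimpleModule_submodule fun m hm ↦
        have := isSimpleModule_iff_isAtom.mpr hm
        inferInstance
    exact congrArg Subtype.val <| Module.mem_annihilator.mp
      (IsSemisimpleModule.jacobson_le_annihilator R (socSub R M) hr) ⟨x, hx⟩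
  · intro hx
    have : IsSemisimpleModule R (Submodule.span R {x}) := by
      refine .of_jacobson_le_annihilator R fun r hr ↦ Module.mem_annihilator.mpr ?_
      rintro ⟨y, hy⟩
      obtain ⟨s, rfl⟩ := Submodule.mem_span_singleton.mp hy
      ext
      simpa [smul_smul] using hx _ (Ideal.mul_mem_right s _ hr)
    have hle : Submodule.span R {x} ≤ socSub R M := by
      rw [← (Submodule.span R {x}).range_subtype, LinearMap.range_eq_map, Submodule.map_le_iff_le_comap,
        ← IsSemisimpleModule.sSup_simples_eq_top]
      refine sSup_le fun m hm ↦ Submodule.map_le_iff_le_comap.mp <| le_sSup ?_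
      have : IsSimpleModule R m := hm
      exact isSimpleModule_iff_isAtom.mp <| .congr
        (Submodule.equivMapOfInjective _ (Submodule.subtype_injective _) m).symm
    exact hle (Submodule.mem_span_singleton_self x)

theorem radPow_eq_jacobson_pow_smul_top (M : Type*) [AddCommGroup M] [Module R M] (n : ℕ) :
    radPow R M n = Ring.jacobson R ^ n • (⊤ : Submodule R M) := by
  induction n with
  | zero => simp [radPow, Submodule.pow_zero, Ideal.one_eq_top]
  | succ n ih =>
    rw [radPow, radSub_eq_jacobson_smul_top, Submodule.map_smul'', Submodule.map_top,
      Submodule.range_subtype, ih, ← Submodule.mul_smul, ← Ideal.IsTwoSided.pow_succ]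

theorem mem_socPow_iff {M : Type*} [AddCommGroup M] [Module R M] {n : ℕ} {x : M} :
    x ∈ socPow R M n ↔ ∀ r ∈ Ring.jacobson R ^ n, r • x = 0 := by
  induction n generalizing x with
  | zero =>
    simp only [socPow, Submodule.mem_bot, Submodule.pow_zero]
    exact ⟨fun h r _ ↦ by simp [h], fun h ↦ by simpa using h 1 (by simp [Ideal.one_eq_top])⟩
  | succ n ih =>
    simp only [socPow, Submodule.mem_comap, mem_socSub_iff, Submodule.mkQ_apply,
      ← Submodule.Quotient.mk_smul, Submodule.Quotient.mk_eq_zero, ih, smul_smul, Submodule.pow_succ]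
    refine ⟨fun h r hr ↦ ?_, fun h r hr s hs ↦ h _ (Ideal.mul_mem_mul hs hr)⟩
    induction hr using Submodule.mul_induction_on' with
    | mem_mul_mem a ha b hb => exact h b hb a ha
    | add a _ b _ h₁ h₂ => rw [add_smul, h₁, h₂, add_zero]

theorem radPow_antitone (M : Type*) [AddCommGroup M] [Module R M] : Antitone (radPow R M) :=
  antitone_nat_of_succ_le fun n ↦ by
    rw [radPow]
    exact Submodule.map_subtype_le _ _

theorem socPow_monotone (M : Type*) [AddCommGroup M] [Module R M] : Monotone (socPow R M) :=
  monotone_nat_of_le_succ fun n ↦ by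
    rw [socPow]
    exact (Submodule.ker_mkQ _).ge.trans (LinearMap.ker_le_comap _)

theorem range_le_socPow_iff {M N : Type*} [AddCommGroup M] [Module R M] [AddCommGroup N]
    [Module R N] (f : M →ₗ[R] N) (n : ℕ) :
    LinearMap.range f ≤ socPow R N n ↔ radPow R M n ≤ LinearMap.ker f := by
  rw [radPow_eq_jacobson_pow_smul_top, Submodule.smul_le]
  constructor
  · intro h r hr x _
    rw [LinearMap.mem_ker, map_smul]
    exact (mem_socPow_iff R).mp (h ⟨x, rfl⟩) r hr
  · rintro h _ ⟨x, rfl⟩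
    refine (mem_socPow_iff R).mpr fun r hr ↦ ?_
    rw [← map_smul]
    exact h r hr x trivial

theorem isSemisimpleModule_radLayer (M : Type*) [AddCommGroup M] [Module R M] (n : ℕ) :
    IsSemisimpleModule R (radLayer R M (n + 1)) := by
  refine .of_jacobson_le_annihilator R fun r hr ↦ Module.mem_annihilator.mpr fun x ↦ ?_
  obtain ⟨x, rfl⟩ := Submodule.mkQ_surjective _ x
  rw [← map_smul, Submodule.mkQ_apply, Submodule.Quotient.mk_eq_zero, Submodule.mem_comap, radPow,
    radSub_eq_jacobson_smul_top]
  exact ⟨_, Submodule.smul_mem_smul hr trivial, rfl⟩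

theorem isSemisimpleModule_socLayer (M : Type*) [AddCommGroup M] [Module R M] (n : ℕ) :
    IsSemisimpleModule R (socLayer R M (n + 1)) := by
  refine .of_jacobson_le_annihilator R fun r hr ↦ Module.mem_annihilator.mpr fun x ↦ ?_
  obtain ⟨⟨x, hx⟩, rfl⟩ := Submodule.mkQ_surjective _ x
  rw [← map_smul, Submodule.mkQ_apply, Submodule.Quotient.mk_eq_zero, Submodule.mem_comap]
  rw [socPow, Submodule.mem_comap, mem_socSub_iff] at hx
  have := hx r hr
  rwa [← map_smul, Submodule.mkQ_apply, Submodule.Quotient.mk_eq_zero] at this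

end Loewy

/-! ### Dimensions of spaces of homomorphisms -/

section Hom

variable (F : Type*) {R : Type*} [Field F] [Ring R]

theorem LinearMap.module_finite_of_finite (M N : Type*) [AddCommGroup M] [Module R M]
    [Module.Finite R M] [AddCommGroup N] [Module R N] [Module F N] [SMulCommClass R F N]
    [Module.Finite F N] : Module.Finite F (M →ₗ[R] N) := by
  obtain ⟨s, hs⟩ := Module.Finite.fg_top (R := R) (M := M)
  let ev : (M →ₗ[R] N) →ₗ[F] (s → N) :=
    { toFun φ x := φ x
      map_add' _ _ := rfl
      map_smul' _ _ := rfl }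
  refine Module.Finite.of_injective ev fun φ ψ h ↦ LinearMap.ext_on hs fun x hx ↦ ?_
  exact congrFun h ⟨x, hx⟩

variable [Algebra F R]

theorem Submodule.module_finite_of_isScalarTower {M : Type*} [AddCommGroup M] [Module R M]
    [Module F M] [IsScalarTower F R M] [Module.Finite F M] (N : Submodule R M) :
    Module.Finite F N :=
  inferInstanceAs (Module.Finite F (N.restrictScalars F))

theorem Submodule.module_finite_quotient_of_isScalarTower {M : Type*} [AddCommGroup M] [Module R M]
    [Module F M] [IsScalarTower F R M] [Module.Finite F M] (N : Submodule R M) :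
    Module.Finite F (M ⧸ N) :=
  .of_surjective (N.mkQ.restrictScalars F) N.mkQ_surjective

theorem module_finite_radLayer {M : Type*} [AddCommGroup M] [Module R M] [Module F M]
    [IsScalarTower F R M] [Module.Finite F M] (n : ℕ) : Module.Finite F (radLayer R M n) :=
  have := Submodule.module_finite_of_isScalarTower F (radPow R M (n - 1))
  Submodule.module_finite_quotient_of_isScalarTower F _

theorem module_finite_socLayer {M : Type*} [AddCommGroup M] [Module R M] [Module F M]
    [IsScalarTower F R M] [Module.Finite F M] (n : ℕ) : Module.Finite F (socLayer R M n) :=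
  have := Submodule.module_finite_of_isScalarTower F (socPow R M n)
  Submodule.module_finite_quotient_of_isScalarTower F _

/-- Composition with isomorphisms on both sides, as a map linear over the base field. -/
def LinearEquiv.homCongr {M M' N N' : Type*} [AddCommGroup M] [Module R M] [AddCommGroup M']
    [Module R M'] [AddCommGroup N] [Module R N] [Module F N] [IsScalarTower F R N]
    [AddCommGroup N'] [Module R N'] [Module F N'] [IsScalarTower F R N']
    (e : M ≃ₗ[R] M') (e' : N ≃ₗ[R] N') : (M →ₗ[R] N) ≃ₗ[F] (M' →ₗ[R] N') where
  __ := e.arrowCongrAddEquiv e'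
  map_smul' c f := LinearMap.ext fun x ↦ e'.toLinearMap.map_smul_of_tower c (f (e.symm x))

/-- Precomposition with a surjection is an isomorphism onto maps if every map kills its kernel. -/
noncomputable def LinearMap.homEquivOfSurjective {M M' N : Type*} [AddCommGroup M] [Module R M]
    [AddCommGroup M'] [Module R M'] [AddCommGroup N] [Module R N] [Module F N]
    [IsScalarTower F R N] (p : M →ₗ[R] M') (hp : Function.Surjective p)
    (h : ∀ f : M →ₗ[R] N, LinearMap.ker p ≤ LinearMap.ker f) :
    (M' →ₗ[R] N) ≃ₗ[F] (M →ₗ[R] N) :=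
  .ofBijective (LinearMap.lcomp F N p)
    ⟨fun _ _ hfg ↦ LinearMap.cancel_right hp |>.mp hfg, fun f ↦
      ⟨((LinearMap.ker p).liftQ f (h f)) ∘ₗ (p.quotKerEquivOfSurjective hp).symm, by
        ext x
        have : (p.quotKerEquivOfSurjective hp).symm (p x) = (LinearMap.ker p).mkQ x := by
          rw [LinearEquiv.symm_apply_eq]; rfl
        simp [this]⟩⟩

theorem LinearMap.finrank_hom_eq_add_quotient {P M : Type*} [AddCommGroup P] [Module R P]
    [Module.Finite R P] [Module.Projective R P] [AddCommGroup M] [Module R M] [Module F M]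
    [IsScalarTower F R M] [Module.Finite F M] (N : Submodule R M) :
    finrank F (P →ₗ[R] M) = finrank F (P →ₗ[R] N) + finrank F (P →ₗ[R] M ⧸ N) := by
  have : Module.Finite F (P →ₗ[R] M) := LinearMap.module_finite_of_finite F P M
  let q : (P →ₗ[R] M) →ₗ[F] (P →ₗ[R] M ⧸ N) := LinearMap.compRight F N.mkQ
  let i : (P →ₗ[R] N) →ₗ[F] (P →ₗ[R] M) := LinearMap.compRight F N.subtype
  have hq : Function.Surjective q := fun f ↦
    Module.projective_lifting_property _ f (Submodule.mkQ_surjective _)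
  have hi : Function.Injective i := fun f g hfg ↦
    (LinearMap.cancel_left N.subtype_injective).mp hfg
  have hr : LinearMap.range i = LinearMap.ker q := by
    ext f
    have hf : f ∈ LinearMap.ker q ↔ ∀ x, f x ∈ N := by
      simp [q, LinearMap.mem_ker, LinearMap.ext_iff]
    rw [hf]
    constructor
    · rintro ⟨g, rfl⟩ x
      exact (g x).2
    · exact fun h ↦ ⟨f.codRestrict N h, rfl⟩
  have := q.finrank_range_add_finrank_ker
  rw [LinearMap.range_eq_top.mpr hq, finrank_top, ← hr, LinearMap.finrank_range_of_inj hi] at this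
  omega

theorem LinearMap.finrank_hom_eq_add_subquotient {P M : Type*} [AddCommGroup P] [Module R P]
    [Module.Finite R P] [Module.Projective R P] [AddCommGroup M] [Module R M] [Module F M]
    [IsScalarTower F R M] [Module.Finite F M] {N N' : Submodule R M} (h : N ≤ N') :
    finrank F (P →ₗ[R] N') =
      finrank F (P →ₗ[R] N) + finrank F (P →ₗ[R] N' ⧸ N.comap N'.subtype) := by
  have := Submodule.module_finite_of_isScalarTower F N'
  rw [LinearMap.finrank_hom_eq_add_quotient F (N.comap N'.subtype),
    ((LinearEquiv.refl R P).homCongr F (Submodule.comapSubtypeEquivOfLe h)).finrank_eq]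

theorem LinearMap.finrank_simple_comm (S T : Type*) [AddCommGroup S] [Module R S] [Module F S]
    [IsScalarTower F R S] [IsSimpleModule R S] [AddCommGroup T] [Module R T] [Module F T]
    [IsScalarTower F R T] [IsSimpleModule R T] :
    finrank F (S →ₗ[R] T) = finrank F (T →ₗ[R] S) := by
  by_cases h : Nonempty (S ≃ₗ[R] T)
  · obtain ⟨e⟩ := h
    exact (e.homCongr F e.symm).finrank_eq
  · have h₁ : Subsingleton (S →ₗ[R] T) := subsingleton_of_forall_eq 0 fun f ↦ by
      by_contra hf
      exact h ⟨.ofBijective f (LinearMap.bijective_of_ne_zero hf)⟩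
    have h₂ : Subsingleton (T →ₗ[R] S) := subsingleton_of_forall_eq 0 fun f ↦ by
      by_contra hf
      exact h ⟨(LinearEquiv.ofBijective f (LinearMap.bijective_of_ne_zero hf)).symm⟩
    rw [finrank_zero_of_subsingleton, finrank_zero_of_subsingleton]

theorem LinearMap.finrank_simple_semisimple_comm (S L : Type*) [AddCommGroup S] [Module R S]
    [Module F S] [IsScalarTower F R S] [IsSimpleModule R S] [Module.Finite F S] [AddCommGroup L]
    [Module R L] [Module F L] [IsScalarTower F R L] [IsSemisimpleModule R L] [Module.Finite F L] :
    finrank F (S →ₗ[R] L) = finrank F (L →ₗ[R] S) := by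
  have : Module.Finite R L := .of_restrictScalars_finite F R L
  obtain ⟨n, T, e, hT⟩ := IsSemisimpleModule.exists_linearEquiv_fin_dfinsupp R L
  have (i : Fin n) := Submodule.module_finite_of_isScalarTower F (T i)
  have (i : Fin n) : Module.Finite F (S →ₗ[R] T i) := LinearMap.module_finite_of_finite F _ _
  have (i : Fin n) : Module.Finite F (T i →ₗ[R] S) := LinearMap.module_finite_of_finite F _ _
  let e' : L ≃ₗ[R] ∀ i, T i := e.trans DFinsupp.linearEquivFunOnFintype
  let toPi : (S →ₗ[R] ∀ i, T i) ≃ₗ[F] ∀ i, S →ₗ[R] T i :=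
    { toFun f i := LinearMap.proj i ∘ₗ f
      invFun := LinearMap.pi
      map_add' _ _ := rfl
      map_smul' _ _ := rfl
      left_inv _ := rfl
      right_inv _ := rfl }
  rw [((LinearEquiv.refl R S).homCongr F e').finrank_eq, toPi.finrank_eq,
    (e'.homCongr F (LinearEquiv.refl R S)).finrank_eq,
    ← (LinearMap.lsum R (fun i ↦ T i) F (M := S)).finrank_eq, Module.finrank_pi_fintype,
    Module.finrank_pi_fintype]
  exact Finset.sum_congr rfl fun i _ ↦ LinearMap.finrank_simple_comm F S (T i)

/-- Maps from a projective cover of `S` into a semisimple module factor through `S`. -/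
noncomputable def IsSemisimpleModule.homEquivOfKerLeRadSub {P S L : Type*} [AddCommGroup P]
    [Module R P] [AddCommGroup S] [Module R S] [AddCommGroup L] [Module R L] [Module F L]
    [IsScalarTower F R L] [IsSemisimpleModule R L] (p : P →ₗ[R] S) (hp : Function.Surjective p)
    (hk : LinearMap.ker p ≤ radSub R P) : (S →ₗ[R] L) ≃ₗ[F] (P →ₗ[R] L) :=
  p.homEquivOfSurjective F hp fun f ↦ hk.trans (IsSemisimpleModule.jacobson_le_ker R R P L f)

/-- Maps `M / rad^n M → N` correspond to maps `M → soc^n N`. -/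
noncomputable def capitalHomEquiv [IsSemiprimaryRing R] (M N : Type*) [AddCommGroup M] [Module R M]
    [AddCommGroup N] [Module R N] [Module F N] [IsScalarTower F R N] (n : ℕ) :
    (capital R M n →ₗ[R] N) ≃ₗ[F] (M →ₗ[R] socPow R N n) where
  toFun f := (f ∘ₗ (radPow R M n).mkQ).codRestrict _ fun x ↦
    (range_le_socPow_iff R (f ∘ₗ (radPow R M n).mkQ) n).mpr
      ((Submodule.ker_mkQ _).ge.trans (LinearMap.ker_le_ker_comp _ _)) ⟨x, rfl⟩
  invFun g := (radPow R M n).liftQ ((socPow R N n).subtype ∘ₗ g) <|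
    (range_le_socPow_iff R _ n).mp <| by
      rintro _ ⟨x, rfl⟩
      exact (g x).2
  map_add' _ _ := rfl
  map_smul' _ _ := rfl
  left_inv f := by ext; rfl
  right_inv g := by ext; rfl

/-- Reciprocity of dimensions, for any module `V` that corepresents the dual of `Hom(Pj, -)` on the
capitals of `Pi`. -/
theorem finrank_radLayer_hom_eq_finrank_hom_socLayer [IsSemiprimaryRing R] {Si Sj Pi Pj V : Type*}
    [AddCommGroup Si] [Module R Si]
    [AddCommGroup Sj] [Module R Sj] [Module F Sj] [IsScalarTower F R Sj] [IsSimpleModule R Sj]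
    [Module.Finite F Sj]
    [AddCommGroup Pi] [Module R Pi] [Module F Pi] [IsScalarTower F R Pi] [Module.Finite F Pi]
    [Module.Finite R Pi] [Module.Projective R Pi]
    [AddCommGroup Pj] [Module R Pj] [Module.Finite R Pj] [Module.Projective R Pj]
    [AddCommGroup V] [Module R V] [Module F V] [IsScalarTower F R V] [Module.Finite F V]
    (πi : Pi →ₗ[R] Si) (hsi : Function.Surjective πi) (hki : LinearMap.ker πi ≤ radSub R Pi)
    (πj : Pj →ₗ[R] Sj) (hsj : Function.Surjective πj) (hkj : LinearMap.ker πj ≤ radSub R Pj)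
    (hV : ∀ k, finrank F (Pj →ₗ[R] capital R Pi k) = finrank F (capital R Pi k →ₗ[R] V)) (n : ℕ) :
    finrank F (radLayer R Pi (n + 1) →ₗ[R] Sj) = finrank F (Si →ₗ[R] socLayer R V (n + 1)) := by
  have := isSemisimpleModule_radLayer R Pi n
  have := isSemisimpleModule_socLayer R V n
  have : Module.Finite F (radLayer R Pi (n + 1)) := module_finite_radLayer F (n + 1)
  have hcap (k : ℕ) : finrank F (Pj →ₗ[R] Pi) =
      finrank F (Pj →ₗ[R] radPow R Pi k) + finrank F (Pi →ₗ[R] socPow R V k) := by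
    rw [← (capitalHomEquiv F Pi V k).finrank_eq, ← hV]
    exact LinearMap.finrank_hom_eq_add_quotient F _
  have hcap_n := hcap n
  have hcap_succ := hcap (n + 1)
  have hrad : finrank F (Pj →ₗ[R] radPow R Pi n) = finrank F (Pj →ₗ[R] radPow R Pi (n + 1)) +
      finrank F (Pj →ₗ[R] radLayer R Pi (n + 1)) :=
    LinearMap.finrank_hom_eq_add_subquotient F (radPow_antitone R Pi n.le_succ)
  have hsoc : finrank F (Pi →ₗ[R] socPow R V (n + 1)) = finrank F (Pi →ₗ[R] socPow R V n) +
      finrank F (Pi →ₗ[R] socLayer R V (n + 1)) :=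
    LinearMap.finrank_hom_eq_add_subquotient F (socPow_monotone R V n.le_succ)
  rw [← LinearMap.finrank_simple_semisimple_comm,
    (IsSemisimpleModule.homEquivOfKerLeRadSub F πj hsj hkj).finrank_eq,
    (IsSemisimpleModule.homEquivOfKerLeRadSub F πi hsi hki).finrank_eq]
  omega

end Hom

section Nakayama

variable (F A : Type*) [Field F] [Ring A] [Algebra F A]

/-- The map `p ↦ x f(p)` attached to `x : X` and `f : P → A`. -/
def rankOneHom {P X : Type*} [AddCommGroup P] [Module Aᵐᵒᵖ P] [AddCommGroup X] [Module Aᵐᵒᵖ X]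
    (x : X) (f : P →ₗ[Aᵐᵒᵖ] A) : P →ₗ[Aᵐᵒᵖ] X where
  toFun p := op (f p) • x
  map_add' p q := by rw [map_add, op_add, add_smul]
  map_smul' a p := by
    rw [map_smul, RingHom.id_apply, smul_smul]
    rfl

theorem exists_dual_basis (P : Type*) [AddCommGroup P] [Module Aᵐᵒᵖ P] [Module.Finite Aᵐᵒᵖ P]
    [Module.Projective Aᵐᵒᵖ P] :
    ∃ (n : ℕ) (b : Fin n → P) (f : Fin n → P →ₗ[Aᵐᵒᵖ] A), ∀ p, ∑ k, op (f k p) • b k = p := by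
  obtain ⟨n, s, g, -, -, hsg⟩ := Module.Finite.exists_comp_eq_id_of_projective Aᵐᵒᵖ P
  let u : Aᵐᵒᵖ →ₗ[Aᵐᵒᵖ] A :=
    { toFun := unop
      map_add' _ _ := rfl
      map_smul' _ _ := rfl }
  refine ⟨n, fun k ↦ s (Pi.single k 1), fun k ↦ u ∘ₗ LinearMap.proj k ∘ₗ g, fun p ↦ ?_⟩
  conv_rhs => rw [← LinearMap.id_apply (R := Aᵐᵒᵖ) p, ← hsg, LinearMap.comp_apply,
    ← LinearMap.sum_single_apply _ (g p), map_sum]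
  refine Finset.sum_congr rfl fun k _ ↦ ?_
  rw [← map_smul, ← Pi.single_smul, smul_eq_mul, mul_one]
  rfl

/-- Nakayama duality `Hom_F(Hom_A(P, X), F) ≅ Hom_A(X, ν P)` for finitely generated projective
`P`. -/
theorem nonempty_dual_hom_equiv_hom_nakayama (P X : Type*) [AddCommGroup P] [Module Aᵐᵒᵖ P]
    [Module.Finite Aᵐᵒᵖ P] [Module.Projective Aᵐᵒᵖ P] [AddCommGroup X] [Module Aᵐᵒᵖ X]
    [Module F X] [IsScalarTower F Aᵐᵒᵖ X] :
    Nonempty (Module.Dual F (P →ₗ[Aᵐᵒᵖ] X) ≃ₗ[F]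
      (X →ₗ[Aᵐᵒᵖ] Module.Dual F (P →ₗ[Aᵐᵒᵖ] A))) := by
  obtain ⟨n, b, f, hbf⟩ := exists_dual_basis A P
  have hX (g : P →ₗ[Aᵐᵒᵖ] X) : ∑ k, rankOneHom A (g (b k)) (f k) = g := by
    ext p
    rw [LinearMap.sum_apply]
    conv_rhs => rw [← hbf p, map_sum]
    simp only [map_smul]
    rfl
  have hA (g : P →ₗ[Aᵐᵒᵖ] A) : ∑ k, g (b k) • f k = g := by
    ext p
    rw [LinearMap.sum_apply]
    conv_rhs => rw [← hbf p, map_sum]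
    simp only [map_smul]
    rfl
  let toHom (l : Module.Dual F (P →ₗ[Aᵐᵒᵖ] X)) : X →ₗ[Aᵐᵒᵖ] Module.Dual F (P →ₗ[Aᵐᵒᵖ] A) :=
    { toFun x :=
        { toFun g := l (rankOneHom A x g)
          map_add' g h := by
            rw [← map_add]; congr 1; ext p
            exact add_smul (op (g p)) (op (h p)) x
          map_smul' c g := by
            rw [RingHom.id_apply, ← map_smul]; congr 1; ext p
            exact smul_assoc c (op (g p)) x }
      map_add' x y := by
        ext g
        refine (congrArg l ?_).trans (map_add l _ _)
        ext p
        exact smul_add (op (g p)) x y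
      map_smul' a x := by
        ext g
        refine congrArg l ?_
        ext p
        exact smul_smul (op (g p)) a x }
  refine ⟨
    { toFun := toHom
      map_add' l m := rfl
      map_smul' c l := rfl
      invFun φ :=
        { toFun g := ∑ k, φ (g (b k)) (f k)
          map_add' g h := by simp [Finset.sum_add_distrib]
          map_smul' c g := by
            simp only [LinearMap.smul_apply, φ.map_smul_of_tower, Finset.smul_sum, RingHom.id_apply] }
      left_inv l := ?_
      right_inv φ := ?_ }⟩
  · ext g
    change ∑ k, l (rankOneHom A (g (b k)) (f k)) = l g
    rw [← map_sum, hX]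
  · ext x g
    change ∑ k, φ (op (g (b k)) • x) (f k) = φ x g
    conv_rhs => rw [← hA g, map_sum]
    simp only [map_smul]
    rfl

end Nakayama

/-- **Reciprocity** (generalized Landrock lemma): for a finite dimensional algebra `A` over a
field `F`, projective covers `Pi`, `Pj` of simple right `A`-modules `Si`, `Sj`, and `n ≥ 1`,
there is an `F`-linear isomorphism
`Hom_A(rad^{n-1} Pi / rad^n Pi, Sj) ≅ Hom_A(Si, soc^n (ν Pj) / soc^{n-1} (ν Pj))`,
where `ν = Hom_F(Hom_A(-, A), F)` is the Nakayama functor.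
Right `A`-modules are rendered as left modules over `Aᵐᵒᵖ`. -/
theorem reciprocity_radLayer_socLayer_nakayama
    (F A : Type*) [Field F] [Ring A] [Algebra F A] [FiniteDimensional F A]
    (Si Sj Pi Pj : Type*)
    [AddCommGroup Si] [Module Aᵐᵒᵖ Si] [Module F Si] [IsScalarTower F Aᵐᵒᵖ Si]
    [IsSimpleModule Aᵐᵒᵖ Si] [Module.Finite Aᵐᵒᵖ Si]
    [AddCommGroup Sj] [Module Aᵐᵒᵖ Sj] [Module F Sj] [IsScalarTower F Aᵐᵒᵖ Sj]
    [IsSimpleModule Aᵐᵒᵖ Sj] [Module.Finite Aᵐᵒᵖ Sj]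
    [AddCommGroup Pi] [Module Aᵐᵒᵖ Pi] [Module F Pi] [IsScalarTower F Aᵐᵒᵖ Pi]
    [Module.Finite Aᵐᵒᵖ Pi] [Module.Projective Aᵐᵒᵖ Pi]
    [AddCommGroup Pj] [Module Aᵐᵒᵖ Pj] [Module F Pj] [IsScalarTower F Aᵐᵒᵖ Pj]
    [Module.Finite Aᵐᵒᵖ Pj] [Module.Projective Aᵐᵒᵖ Pj]
    (πi : Pi →ₗ[Aᵐᵒᵖ] Si) (hsi : Function.Surjective πi)
    (hki : LinearMap.ker πi ≤ radSub Aᵐᵒᵖ Pi)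
    (πj : Pj →ₗ[Aᵐᵒᵖ] Sj) (hsj : Function.Surjective πj)
    (hkj : LinearMap.ker πj ≤ radSub Aᵐᵒᵖ Pj)
    (n : ℕ) (hn : 1 ≤ n) :
    Nonempty ((radLayer Aᵐᵒᵖ Pi n →ₗ[Aᵐᵒᵖ] Sj) ≃ₗ[F]
      (Si →ₗ[Aᵐᵒᵖ] socLayer Aᵐᵒᵖ (Module.Dual F (Pj →ₗ[Aᵐᵒᵖ] A)) n)) := by
  have : Module.Finite F Aᵐᵒᵖ := .equiv (opLinearEquiv F (M := A))
  have : IsArtinianRing Aᵐᵒᵖ := .of_finite F Aᵐᵒᵖ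
  have : Module.Finite F Sj := .trans Aᵐᵒᵖ Sj
  have : Module.Finite F Pi := .trans Aᵐᵒᵖ Pi
  have : Module.Finite F (Pj →ₗ[Aᵐᵒᵖ] A) := LinearMap.module_finite_of_finite F Pj A
  obtain ⟨n, rfl⟩ := Nat.exists_eq_add_of_le' hn
  have : Module.Finite F (radLayer Aᵐᵒᵖ Pi (n + 1) →ₗ[Aᵐᵒᵖ] Sj) :=
    have := module_finite_radLayer F (R := Aᵐᵒᵖ) (M := Pi) (n + 1)
    have : Module.Finite Aᵐᵒᵖ (radLayer Aᵐᵒᵖ Pi (n + 1)) := .of_restrictScalars_finite F _ _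
    LinearMap.module_finite_of_finite F _ _
  have : Module.Finite F
      (Si →ₗ[Aᵐᵒᵖ] socLayer Aᵐᵒᵖ (Module.Dual F (Pj →ₗ[Aᵐᵒᵖ] A)) (n + 1)) :=
    have := module_finite_socLayer F (R := Aᵐᵒᵖ) (M := Module.Dual F (Pj →ₗ[Aᵐᵒᵖ] A)) (n + 1)
    LinearMap.module_finite_of_finite F _ _
  refine FiniteDimensional.nonempty_linearEquiv_of_finrank_eq <|
    finrank_radLayer_hom_eq_finrank_hom_socLayer F πi hsi hki πj hsj hkj (fun k ↦ ?_) n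
  obtain ⟨e⟩ := nonempty_dual_hom_equiv_hom_nakayama F A Pj (capital Aᵐᵒᵖ Pi k)
  rw [← e.finrank_eq, Subspace.dual_finrank_eq]
end

section
/- Let A be a finite-dimensional algebra over a field F, let P be a finitely generated projective right A-module, and let n ≥ 1 be an integer. Then there is an isomorphism of right A^op-modules rad^{n-1}(P^t)/rad^n(P^t) ≅ (soc^n(ν P)/soc^{n-1}(ν P))^*, where P^t = Hom_A(P, A) is the A-dual of P, ν is the Nakayama functor, and (-)^* = Hom_F(-, F); that is, the n-th radical layer of the A-dual of P is the F-dual of the n-th socle layer of ν P. -/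
set_option linter.unusedSectionVars false
set_option synthInstance.maxHeartbeats 1000000
set_option maxHeartbeats 1000000

open Module MulOpposite

section LoewyLattice

variable {R M : Type*} [Ring R] [AddCommGroup M] [Module R M]

/-- The radical of a submodule, in terms of the submodule lattice of the ambient module. -/
lemma map_subtype_radSub (N : Submodule R M) :
    (radSub R N).map N.subtype = N ⊓ sInf {K | K ⋖ N} := by
  ext x
  simp only [radSub, Submodule.mem_map, Submodule.mem_sInf, Submodule.mem_inf, Set.mem_ofPred_eq]
  constructor
  · rintro ⟨y, hy, rfl⟩
    refine ⟨y.2, fun K hK => ?_⟩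
    have hc : IsCoatom (K.comap N.subtype) := by
      rw [← N.mapIic.isCoatom_iff]
      have e : N.mapIic (K.comap N.subtype) = ⟨K, hK.le⟩ := Subtype.ext <| by simpa using hK.le
      rw [e]
      exact (covBy_iff_coatom_Iic hK.le).1 hK
    exact hy _ hc
  · rintro ⟨hx, h⟩
    refine ⟨⟨x, hx⟩, fun K hK => ?_, rfl⟩
    have hc := (covBy_iff_coatom_Iic (N.mapIic K).2).2 ((N.mapIic.isCoatom_iff K).2 hK)
    obtain ⟨y, hy, e⟩ := h _ hc
    rwa [← Subtype.ext (a1 := y) (a2 := ⟨x, hx⟩) e]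

/-- The preimage of the socle of a quotient, in terms of the submodule lattice. -/
lemma comap_mkQ_socSub (N : Submodule R M) :
    (socSub R (M ⧸ N)).comap N.mkQ = N ⊔ sSup {K | N ⋖ K} := by
  apply le_antisymm
  · suffices h : socSub R (M ⧸ N) ≤ (sSup {K | N ⋖ K}).map N.mkQ by
      rw [← Submodule.comap_map_mkQ]
      exact Submodule.comap_mono h
    refine sSup_le fun K hK => ?_
    have hc := (covBy_iff_atom_Ici (N.comapMkQRelIso K).2).2
      ((N.comapMkQRelIso.isAtom_iff K).2 hK)
    have e : K = (K.comap N.mkQ).map N.mkQ :=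
      (Submodule.map_comap_eq_of_surjective N.mkQ_surjective K).symm
    rw [e]
    exact Submodule.map_mono (le_sSup hc)
  · refine sup_le (N.le_comap_mkQ _) (sSup_le fun K hK => ?_)
    have hK' : (K.map N.mkQ).comap N.mkQ = K := by
      rw [Submodule.comap_map_mkQ, sup_eq_right.2 hK.le]
    have hc : IsAtom (K.map N.mkQ) := by
      rw [← N.comapMkQRelIso.isAtom_iff]
      have e : N.comapMkQRelIso (K.map N.mkQ) = ⟨K, hK.le⟩ := Subtype.ext hK'
      rw [e]
      exact (covBy_iff_atom_Ici hK.le).1 hK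
    rw [← hK']
    exact Submodule.comap_mono (le_sSup hc)

/-- The section of a module given by two submodules. -/
abbrev Submodule.layer (N N' : Submodule R M) :=
  ↥N ⧸ N'.comap N.subtype

lemma socPow_le_succ (n : ℕ) : socPow R M n ≤ socPow R M (n + 1) :=
  Submodule.le_comap_mkQ _ _

end LoewyLattice

section Annihilator

variable {F A M : Type*} [Field F] [Ring A] [Algebra F A] [AddCommGroup M] [Module F M]
  [Module A M] [IsScalarTower F A M]

variable (F) in
/-- The functionals vanishing on a submodule, as a submodule of the contragredient dual. -/
noncomputable def Submodule.contragredientAnnihilator (N : Submodule A M) :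
    Submodule Aᵐᵒᵖ (Module.Dual F M) where
  __ := (N.restrictScalars F).dualAnnihilator
  smul_mem' a _ hφ := (Submodule.mem_dualAnnihilator _).2 fun _ hm =>
    (Submodule.mem_dualAnnihilator _).1 hφ _ (N.smul_mem a.unop hm)

/-- The common zeros of a submodule of the contragredient dual. -/
noncomputable def Submodule.contragredientCoannihilator (S : Submodule Aᵐᵒᵖ (Module.Dual F M)) :
    Submodule A M where
  __ := (S.restrictScalars F).dualCoannihilator
  smul_mem' a _ hm := (Submodule.mem_dualCoannihilator _).2 fun _ hφ =>
    (Submodule.mem_dualCoannihilator _).1 hm _ (S.smul_mem (op a) hφ)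

lemma Submodule.mem_contragredientCoannihilator {S : Submodule Aᵐᵒᵖ (Module.Dual F M)} {m : M} :
    m ∈ S.contragredientCoannihilator ↔ ∀ φ ∈ S, φ m = 0 :=
  Submodule.mem_dualCoannihilator (Φ := S.restrictScalars F) m

lemma Submodule.contragredientCoannihilator_contragredientAnnihilator (N : Submodule A M) :
    (N.contragredientAnnihilator F).contragredientCoannihilator = N :=
  SetLike.coe_injective <| congrArg (fun W : Subspace F M => (W : Set M)) <|
    Subspace.dualAnnihilator_dualCoannihilator_eq (W := N.restrictScalars F)

lemma Submodule.contragredientAnnihilator_contragredientCoannihilator [FiniteDimensional F M]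
    (S : Submodule Aᵐᵒᵖ (Module.Dual F M)) :
    S.contragredientCoannihilator.contragredientAnnihilator F = S :=
  SetLike.coe_injective <|
    congrArg (fun W : Subspace F (Module.Dual F M) => (W : Set (Module.Dual F M))) <|
      Subspace.dualCoannihilator_dualAnnihilator_eq (W := S.restrictScalars F)

variable (F A M) in
/-- In finite dimension, annihilators give an anti-isomorphism between the submodule lattices
of a module and of its contragredient dual. -/
noncomputable def contragredientAnnihilatorIso [FiniteDimensional F M] :
    Submodule A M ≃o (Submodule Aᵐᵒᵖ (Module.Dual F M))ᵒᵈ where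
  toFun N := OrderDual.toDual (N.contragredientAnnihilator F)
  invFun S := (OrderDual.ofDual S).contragredientCoannihilator
  left_inv := Submodule.contragredientCoannihilator_contragredientAnnihilator
  right_inv S := Submodule.contragredientAnnihilator_contragredientCoannihilator
    (OrderDual.ofDual S)
  map_rel_iff' {N N'} :=
    Subspace.dualAnnihilator_le_dualAnnihilator_iff (W := N'.restrictScalars F)
      (W' := N.restrictScalars F)

/-- The `n`-th socle of the dual consists of the functionals vanishing on the `n`-th radical. -/
lemma contragredientAnnihilator_radPow [FiniteDimensional F M] (n : ℕ) :
    (radPow A M n).contragredientAnnihilator F = socPow Aᵐᵒᵖ (Module.Dual F M) n := by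
  let e := contragredientAnnihilatorIso F A M
  suffices h : e (radPow A M n) = OrderDual.toDual (socPow Aᵐᵒᵖ (Module.Dual F M) n) from
    OrderDual.toDual.injective h
  induction n with
  | zero => exact e.map_top
  | succ n ih =>
    rw [radPow, socPow, map_subtype_radSub, comap_mkQ_socSub, map_inf, ih, toDual_sup,
      e.map_sInf_eq_sInf_symm_preimage, toDual_sSup]
    congr 2
    ext K
    obtain ⟨K, rfl⟩ := e.surjective K
    simp only [Set.mem_preimage, OrderIso.symm_apply_apply, Set.mem_ofPred_eq]
    rw [← apply_covBy_apply_iff e, ih]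
    exact toDual_covBy_toDual_iff.symm

end Annihilator

section LayerFunctional

variable {F R D : Type*} [Field F] [Ring R] [Algebra F R] [AddCommGroup D] [Module F D]
  [Module R D] [IsScalarTower F R D]

/-- The functional induced on a section of a module by a functional vanishing on the
smaller submodule. -/
noncomputable def layerFunctional (S' S : Submodule R D) (l : Module.Dual F D)
    (hl : ∀ φ ∈ S, l φ = 0) : Module.Dual F (S'.layer S) :=
  (((S.comap S'.subtype).restrictScalars F).liftQ (l.comp (S'.subtype.restrictScalars F))
    fun φ hφ => hl φ hφ).comp
    (Submodule.Quotient.restrictScalarsEquiv F (S.comap S'.subtype)).symm.toLinearMap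

lemma layerFunctional_mk (S' S : Submodule R D) (l : Module.Dual F D)
    (hl : ∀ φ ∈ S, l φ = 0) (φ : S') :
    layerFunctional S' S l hl (Submodule.Quotient.mk φ) = l φ :=
  rfl

lemma exists_layerFunctional_eq (S' S : Submodule R D) (hS : S ≤ S')
    (f : Module.Dual F (S'.layer S)) :
    ∃ (l : Module.Dual F D) (hl : ∀ φ ∈ S, l φ = 0), layerFunctional S' S l hl = f := by
  obtain ⟨g, hg⟩ := LinearMap.exists_extend (p := S'.restrictScalars F)
    (f.comp ((S.comap S'.subtype).mkQ.restrictScalars F))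
  have hf (φ : S') : g φ = f (Submodule.Quotient.mk φ) :=
    LinearMap.congr_fun hg (φ : S'.restrictScalars F)
  refine ⟨g, fun φ hφ => ?_, LinearMap.ext fun φ => ?_⟩
  · have h0 : (⟨φ, hS hφ⟩ : S') ∈ S.comap S'.subtype := hφ
    rw [hf ⟨φ, hS hφ⟩, (Submodule.Quotient.mk_eq_zero _).2 h0, map_zero]
  · obtain ⟨φ, rfl⟩ := Submodule.Quotient.mk_surjective _ φ
    exact hf φ

end LayerFunctional

section EvalLayer

variable {F A M D : Type*} [Field F] [Ring A] [Algebra F A] [AddCommGroup M] [Module A M]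
  [AddCommGroup D] [Module F D] [Module Aᵐᵒᵖ D] [IsScalarTower F Aᵐᵒᵖ D]

/-- A map to the dual of `D` induces a map from a submodule to the dual of a section of `D`. -/
noncomputable def evalLayer (ev : M →ₗ[A] Module.Dual F D) (N : Submodule A M)
    (S' S : Submodule Aᵐᵒᵖ D) (h : ∀ m ∈ N, ∀ φ ∈ S, ev m φ = 0) :
    N →ₗ[A] Module.Dual F (S'.layer S) where
  toFun r := layerFunctional S' S (ev r) (h r r.2)
  map_add' r r' := by
    refine LinearMap.ext fun φ => ?_
    obtain ⟨φ, rfl⟩ := Submodule.Quotient.mk_surjective _ φ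
    simp only [LinearMap.add_apply, layerFunctional_mk, Submodule.coe_add, map_add]
  map_smul' a r := by
    refine LinearMap.ext fun φ => ?_
    obtain ⟨φ, rfl⟩ := Submodule.Quotient.mk_surjective _ φ
    rw [RingHom.id_apply, dualModuleOfRight_smul_apply, ← Submodule.Quotient.mk_smul]
    simp only [layerFunctional_mk, Submodule.coe_smul, map_smul, dualModuleOfRight_smul_apply]

/-- If `M` is identified with the dual of `D`, then sections of `M` are dual to the corresponding
sections of `D`. -/
lemma nonempty_layer_equiv_dual_layer (ev : M →ₗ[A] Module.Dual F D)
    (hev : Function.Surjective ev) (N N' : Submodule A M) (S' S : Submodule Aᵐᵒᵖ D) (hS : S ≤ S')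
    (hN : ∀ m, m ∈ N ↔ ∀ φ ∈ S, ev m φ = 0) (hN' : ∀ m, m ∈ N' ↔ ∀ φ ∈ S', ev m φ = 0) :
    Nonempty (N.layer N' ≃ₗ[A] Module.Dual F (S'.layer S)) := by
  let f := evalLayer ev N S' S fun m hm => (hN m).1 hm
  have hker : N'.comap N.subtype = LinearMap.ker f := by
    ext r
    rw [LinearMap.mem_ker, Submodule.mem_comap, hN']
    constructor
    · refine fun hr => LinearMap.ext fun φ => ?_
      obtain ⟨φ, rfl⟩ := Submodule.Quotient.mk_surjective _ φ
      exact hr φ φ.2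
    · exact fun hr φ hφ => LinearMap.congr_fun hr (Submodule.Quotient.mk ⟨φ, hφ⟩)
  have hsurj : Function.Surjective f := by
    intro g
    obtain ⟨l, hl, rfl⟩ := exists_layerFunctional_eq S' S hS g
    obtain ⟨m, rfl⟩ := hev l
    exact ⟨⟨m, (hN m).2 hl⟩, rfl⟩
  exact ⟨(Submodule.quotEquivOfEq _ _ hker).trans (f.quotKerEquivOfSurjective hsurj)⟩

end EvalLayer

section RadLayerDual

variable (F A M : Type*) [Field F] [Ring A] [Algebra F A] [AddCommGroup M] [Module F M]
  [Module A M] [IsScalarTower F A M]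

/-- The evaluation map to the double dual, as a map of `A`-modules. -/
noncomputable def contragredientEval : M →ₗ[A] Module.Dual F (Module.Dual F M) where
  toFun := Module.Dual.eval F M
  map_add' := map_add _
  map_smul' _ _ := rfl

/-- For a finite-dimensional module, radical layers are dual to the socle layers of the dual. -/
theorem nonempty_radLayer_equiv_dual_socLayer_dual [FiniteDimensional F M] (n : ℕ) :
    Nonempty (radLayer A M (n + 1) ≃ₗ[A]
      Module.Dual F (socLayer Aᵐᵒᵖ (Module.Dual F M) (n + 1))) := by
  have h (k : ℕ) (m : M) : m ∈ radPow A M k ↔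
      ∀ φ ∈ socPow Aᵐᵒᵖ (Module.Dual F M) k, contragredientEval F A M m φ = 0 := by
    rw [← contragredientAnnihilator_radPow]
    conv_lhs => rw [← Submodule.contragredientCoannihilator_contragredientAnnihilator (F := F)
      (radPow A M k)]
    exact Submodule.mem_contragredientCoannihilator
  exact nonempty_layer_equiv_dual_layer (contragredientEval F A M)
    (Module.evalEquiv F M).surjective _ _ _ _ (socPow_le_succ n) (h n) (h (n + 1))

end RadLayerDual

/-- For a finite dimensional algebra `A` over a field `F`, a finitely generated projective
right `A`-module `P`, and `n ≥ 1`, the `n`-th radical layer of the `A`-dual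
`P^t = Hom_A(P, A)` is isomorphic, as a right `Aᵒᵖ`-module (= left `A`-module), to the
`F`-dual of the `n`-th socle layer of the Nakayama transform `ν P = Hom_F(P^t, F)`.
Right `A`-modules are rendered as left modules over `Aᵐᵒᵖ`. -/
theorem radLayer_dual_iso_dual_socLayer_nakayama
    (F A : Type*) [Field F] [Ring A] [Algebra F A] [FiniteDimensional F A]
    (P : Type*) [AddCommGroup P] [Module Aᵐᵒᵖ P] [Module F P] [IsScalarTower F Aᵐᵒᵖ P]
    [Module.Finite Aᵐᵒᵖ P] [Module.Projective Aᵐᵒᵖ P]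
    (n : ℕ) (hn : 1 ≤ n) :
    Nonempty ((radLayer A (P →ₗ[Aᵐᵒᵖ] A) n) ≃ₗ[A]
      Module.Dual F (socLayer Aᵐᵒᵖ (Module.Dual F (P →ₗ[Aᵐᵒᵖ] A)) n)) := by
  obtain ⟨n, rfl⟩ := Nat.exists_eq_add_of_le' hn
  have : Module.Finite F P := Module.Finite.trans Aᵐᵒᵖ P
  have : FiniteDimensional F (P →ₗ[Aᵐᵒᵖ] A) :=
    FiniteDimensional.of_injective (LinearMap.restrictScalarsₗ F Aᵐᵒᵖ P A F)
      (LinearMap.restrictScalars_injective F)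
  exact nonempty_radLayer_equiv_dual_socLayer_dual F A _ n
end
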